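/- Let n = 2 and let Δ = π(Δ̂) ⊂ V be the root system of psl(2|2) as in the context. Set P(1|1) := {±π(ε₁ − δ₁), ±π(ε₂ − δ₂)} ∪ {π(ε₁ − ε₂), π(δ₁ − δ₂), π(ε₁ − δ₂), π(δ₁ − ε₂)}. Then a subset P ⊆ Δ is a cominuscule parabolic set of roots of Δ if and only if σ(P) = P(1|1) for some σ ∈ S₂ × S₂; in particular P(1|1) is itself a cominuscule parabolic set of roots. -/

import Mathlib

open Pointwise

/-- A proper subset `P` of a symmetric root set `Δ` is a parabolic set of roots if
`Δ = P ∪ (-P)` and `P` is closed under sums lying in `Δ`. -/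
def IsParabolic {V : Type*} [AddCommGroup V] (Δ P : Set V) : Prop :=
  P ⊂ Δ ∧ Δ = P ∪ (-P) ∧ ∀ α ∈ P, ∀ β ∈ P, α + β ∈ Δ → α + β ∈ P

/-- A parabolic set of roots is cominuscule if the sum of any two elements of its
nilradical `N⁺ = P \ (-P)` is not a root. -/
def IsCominuscule {V : Type*} [AddCommGroup V] (Δ P : Set V) : Prop :=
  IsParabolic Δ P ∧ ∀ α ∈ P \ (-P), ∀ β ∈ P \ (-P), α + β ∉ Δ

namespace PSL2

/-- `ℝ⁴`, with coordinates indexed by `Fin 2 ⊕ Fin 2`. -/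
abbrev W := (Fin 2 ⊕ Fin 2) → ℝ

noncomputable def ε (i : Fin 2) : W := Pi.single (Sum.inl i) 1

noncomputable def δ (k : Fin 2) : W := Pi.single (Sum.inr k) 1

noncomputable def ω : W := (ε 0 + ε 1) - (δ 0 + δ 1)

/-- `V = ℝ⁴ / ℝω`. -/
abbrev V := W ⧸ (Submodule.span ℝ {ω})

noncomputable def π : W →ₗ[ℝ] V := (Submodule.span ℝ {ω}).mkQ

/-- The roots of `sl(2|2)` in `ℝ⁴`. -/
noncomputable def Δhat : Set W :=
  {v | ∃ i j : Fin 2, i ≠ j ∧ v = ε i - ε j} ∪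
  {v | ∃ k l : Fin 2, k ≠ l ∧ v = δ k - δ l} ∪
  {v | ∃ i l : Fin 2, v = ε i - δ l ∨ v = δ l - ε i}

/-- The root system of `psl(2|2)`. -/
noncomputable def Δroot : Set V := π '' Δhat

/-- The cominuscule parabolic set `P(1|1)`. -/
noncomputable def P11 : Set V :=
  {π (ε 0 - δ 0), -π (ε 0 - δ 0), π (ε 1 - δ 1), -π (ε 1 - δ 1),
   π (ε 0 - ε 1), π (δ 0 - δ 1), π (ε 0 - δ 1), π (δ 0 - ε 1)}

/-- The action of `(σ, τ) ∈ S₂ × S₂` on `ℝ⁴`, permuting the `ε`'s and `δ`'s;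
it fixes `ω` and hence descends to `V`. -/
def permAct (σ τ : Equiv.Perm (Fin 2)) : W → W :=
  fun v => v ∘ (Equiv.sumCongr σ τ).symm

/-- The image of `P ⊆ Δ` under the descended action of `(σ, τ)` on `V`. -/
noncomputable def act (σ τ : Equiv.Perm (Fin 2)) (P : Set V) : Set V :=
  π '' (permAct σ τ '' (Δhat ∩ π ⁻¹' P))

end PSL2

theorem image_neg_of_addHom {G H : Type*} [AddCommGroup G] [AddCommGroup H] (f : G →+ H)
    (P : Set G) : -(f '' P) = f '' (-P) := by
  ext x
  simp only [Set.mem_neg, Set.mem_image]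
  constructor
  · rintro ⟨y, hy, hyx⟩
    exact ⟨-y, by simpa using hy, by rw [map_neg, hyx, neg_neg]⟩
  · rintro ⟨y, hy, rfl⟩
    exact ⟨-y, hy, map_neg f y⟩

theorem isParabolic_image_iff {G H : Type*} [AddCommGroup G] [AddCommGroup H] {f : G →+ H}
    (hf : Function.Injective f) (D P : Set G) :
    IsParabolic (f '' D) (f '' P) ↔ IsParabolic D P := by
  unfold IsParabolic
  rw [image_neg_of_addHom, ← Set.image_union, hf.image_injective.eq_iff]
  simp only [ssubset_iff_subset_not_subset, Set.image_subset_image_iff hf, Set.forall_mem_image, ← map_add, hf.mem_set_image]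

theorem isCominuscule_image_iff {G H : Type*} [AddCommGroup G] [AddCommGroup H] {f : G →+ H}
    (hf : Function.Injective f) (D P : Set G) :
    IsCominuscule (f '' D) (f '' P) ↔ IsCominuscule D P := by
  unfold IsCominuscule
  rw [isParabolic_image_iff hf, image_neg_of_addHom, ← Set.image_sdiff hf]
  simp only [Set.forall_mem_image, ← map_add, hf.mem_set_image]

theorem isCominuscule_coe_iff {G : Type*} [AddCommGroup G] [DecidableEq G] (D P : Finset G) :
    IsCominuscule (D : Set G) (P : Set G) ↔
      (P ⊂ D ∧ D = P ∪ -P ∧ ∀ α ∈ P, ∀ β ∈ P, α + β ∈ D → α + β ∈ P) ∧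
        ∀ α ∈ P \ -P, ∀ β ∈ P \ -P, α + β ∉ D := by
  unfold IsCominuscule IsParabolic
  norm_cast

namespace PSL2

/-- The lift to `W` of integral combinations of `ε 0 - δ 0` and `ε 0 - δ 1`. -/
noncomputable def oddLift : ℤ × ℤ →+ W where
  toFun x := x.1 • (ε 0 - δ 0) + x.2 • (ε 0 - δ 1)
  map_zero' := by simp
  map_add' x y := by simp only [Prod.fst_add, Prod.snd_add, add_smul]; abel

/-- The integral coordinates on `V` for which the odd roots are `±(1, 0)` and `±(0, 1)`. -/
noncomputable def oddCoord : ℤ × ℤ →+ V := π.toAddMonoidHom.comp oddLift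

theorem π_eq_iff (v w : W) : π v = π w ↔ ∃ c : ℝ, c • ω = v - w := by
  rw [← Submodule.mem_span_singleton, π, Submodule.mkQ_apply, Submodule.mkQ_apply,
    Submodule.Quotient.eq]

theorem W.ext_iff (v w : W) : v = w ↔
    v (.inl 0) = w (.inl 0) ∧ v (.inl 1) = w (.inl 1) ∧
      v (.inr 0) = w (.inr 0) ∧ v (.inr 1) = w (.inr 1) := by
  simp [funext_iff, Sum.forall, Fin.forall_fin_two, and_assoc]

theorem oddCoord_injective : Function.Injective oddCoord := by
  rintro ⟨a, b⟩ ⟨c, d⟩ h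
  obtain ⟨t, ht⟩ := (π_eq_iff _ _).1 h
  rw [W.ext_iff] at ht
  simp [oddLift, ω, ε, δ] at ht
  obtain ⟨h0, h1, h2, h3⟩ := ht
  subst h1
  rw [Prod.mk.injEq]
  constructor
  · have : (a : ℝ) = c := by linarith
    exact_mod_cast this
  · have : (b : ℝ) = d := by linarith
    exact_mod_cast this

/-- The roots of `psl(2|2)` in integral coordinates. -/
def rootCoords : Finset (ℤ × ℤ) :=
  {(1, 0), (-1, 0), (0, 1), (0, -1), (1, 1), (-1, -1), (-1, 1), (1, -1)}

/-- The set `P(1|1)` in integral coordinates. -/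
def P11Coords : Finset (ℤ × ℤ) := {(1, 0), (-1, 0), (1, 1), (-1, 1), (0, 1)}

theorem π_ε_sub_ε : π (ε 0 - ε 1) = oddCoord (1, 1) :=
  (π_eq_iff _ _).2 ⟨-1, by simp [oddLift, ω]; abel⟩

theorem π_δ_sub_δ : π (δ 0 - δ 1) = oddCoord (-1, 1) :=
  (π_eq_iff _ _).2 ⟨0, by simp [oddLift]⟩

theorem π_ε_zero_sub_δ_zero : π (ε 0 - δ 0) = oddCoord (1, 0) := by simp [oddCoord, oddLift]

theorem π_ε_zero_sub_δ_one : π (ε 0 - δ 1) = oddCoord (0, 1) := by simp [oddCoord, oddLift]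

theorem π_ε_one_sub_δ_zero : π (ε 1 - δ 0) = oddCoord (0, -1) :=
  (π_eq_iff _ _).2 ⟨1, by simp [oddLift, ω]; abel⟩

theorem π_ε_one_sub_δ_one : π (ε 1 - δ 1) = oddCoord (-1, 0) :=
  (π_eq_iff _ _).2 ⟨1, by simp [oddLift, ω]; abel⟩

theorem π_sub_comm (v w : W) : π (v - w) = -π (w - v) := by rw [← map_neg, neg_sub]

theorem Δroot_eq : Δroot = oddCoord '' rootCoords := by
  have hΔ : Δhat = {ε 0 - ε 1, ε 1 - ε 0, δ 0 - δ 1, δ 1 - δ 0, ε 0 - δ 0, δ 0 - ε 0,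
      ε 0 - δ 1, δ 1 - ε 0, ε 1 - δ 0, δ 0 - ε 1, ε 1 - δ 1, δ 1 - ε 1} := by
    ext v
    simp [Δhat, Fin.exists_fin_two]
    tauto
  simp only [Δroot, hΔ, Set.image_insert_eq, Set.image_singleton, π_sub_comm (ε 1) (ε 0),
    π_sub_comm (δ 1) (δ 0), π_sub_comm (δ _) (ε _), π_ε_sub_ε, π_δ_sub_δ, π_ε_zero_sub_δ_zero,
    π_ε_zero_sub_δ_one, π_ε_one_sub_δ_zero, π_ε_one_sub_δ_one, ← map_neg, rootCoords,
    Finset.coe_insert, Finset.coe_singleton, Prod.neg_mk, neg_neg, neg_zero]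
  ext v
  simp only [Set.mem_insert_iff, Set.mem_singleton_iff]
  tauto

theorem P11_eq : P11 = oddCoord '' P11Coords := by
  simp only [P11, Set.image_insert_eq, Set.image_singleton, π_sub_comm (δ _) (ε _),
    π_ε_sub_ε, π_δ_sub_δ, π_ε_zero_sub_δ_zero, π_ε_zero_sub_δ_one, π_ε_one_sub_δ_zero,
    π_ε_one_sub_δ_one, ← map_neg, P11Coords, Finset.coe_insert, Finset.coe_singleton, Prod.neg_mk,
    neg_neg, neg_zero]
  ext v
  simp only [Set.mem_insert_iff, Set.mem_singleton_iff]
  tauto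

/-- The action of `S₂ × S₂` in integral coordinates. -/
def permCoords (σ τ : Equiv.Perm (Fin 2)) (x : ℤ × ℤ) : ℤ × ℤ :=
  if σ 0 = 0 then if τ 0 = 0 then x else x.swap
  else if τ 0 = 0 then -x.swap else -x

theorem perm_fin_two (σ : Equiv.Perm (Fin 2)) : σ = Equiv.refl _ ∨ σ = Equiv.swap 0 1 := by
  revert σ; decide

theorem permAct_inl (σ τ : Equiv.Perm (Fin 2)) (v : W) (i : Fin 2) :
    permAct σ τ v (.inl i) = v (.inl (σ.symm i)) := rfl

theorem permAct_inr (σ τ : Equiv.Perm (Fin 2)) (v : W) (k : Fin 2) :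
    permAct σ τ v (.inr k) = v (.inr (τ.symm k)) := rfl

theorem π_permAct_of_π_eq (σ τ : Equiv.Perm (Fin 2)) {v w : W} (h : π v = π w) :
    π (permAct σ τ v) = π (permAct σ τ w) := by
  obtain ⟨c, hc⟩ := (π_eq_iff _ _).1 h
  refine (π_eq_iff _ _).2 ⟨c, ?_⟩
  have hω : permAct σ τ ω = ω := by
    rw [W.ext_iff]
    rcases perm_fin_two σ with rfl | rfl <;> rcases perm_fin_two τ with rfl | rfl <;>
      simp [permAct_inl, permAct_inr, ω, ε, δ]
  calc c • ω = permAct σ τ (c • ω) := by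
        conv_lhs => rw [← hω]
        rfl
    _ = permAct σ τ v - permAct σ τ w := by rw [hc]; rfl

theorem π_permAct_oddLift (σ τ : Equiv.Perm (Fin 2)) (x : ℤ × ℤ) :
    π (permAct σ τ (oddLift x)) = oddCoord (permCoords σ τ x) := by
  obtain ⟨a, b⟩ := x
  have key : ∃ c : ℝ, c • ω = permAct σ τ (oddLift (a, b)) - oddLift (permCoords σ τ (a, b)) := by
    simp only [W.ext_iff]
    rcases perm_fin_two σ with rfl | rfl
    · refine ⟨0, ?_⟩
      rcases perm_fin_two τ with rfl | rfl <;>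
        simp [permAct_inl, permAct_inr, permCoords, oddLift, ω, ε, δ, add_comm]
    · refine ⟨a + b, ?_⟩
      rcases perm_fin_two τ with rfl | rfl <;>
        simp [permAct_inl, permAct_inr, permCoords, oddLift, ω, ε, δ] <;> ring_nf <;> trivial
  exact (π_eq_iff _ _).2 key

theorem act_oddCoord_image (σ τ : Equiv.Perm (Fin 2)) {p : Finset (ℤ × ℤ)}
    (hp : p ⊆ rootCoords) :
    act σ τ (oddCoord '' p) = oddCoord '' (p.image (permCoords σ τ) : Finset (ℤ × ℤ)) := by
  have hroot : ∀ x ∈ p, ∃ v ∈ Δhat, π v = oddCoord x := fun x hx => by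
    have : oddCoord x ∈ Δroot := Δroot_eq ▸ Set.mem_image_of_mem _ (hp hx)
    exact this
  have hact {v : W} {x : ℤ × ℤ} (h : π v = oddCoord x) :
      π (permAct σ τ v) = oddCoord (permCoords σ τ x) := by
    rw [← π_permAct_oddLift]
    exact π_permAct_of_π_eq σ τ h
  ext y
  simp only [act, Set.mem_image, Set.mem_inter_iff, Set.mem_preimage, Finset.coe_image,
    exists_exists_and_eq_and]
  constructor
  · rintro ⟨v, ⟨-, x, hx, hxv⟩, rfl⟩
    exact ⟨x, hx, (hact hxv.symm).symm⟩
  · rintro ⟨x, hx, rfl⟩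
    obtain ⟨v, hv, hvx⟩ := hroot x hx
    exact ⟨v, ⟨hv, x, hx, hvx.symm⟩, hact hvx⟩

theorem isCominuscule_rootCoords_iff : ∀ p ∈ rootCoords.powerset,
    ((p ⊂ rootCoords ∧ rootCoords = p ∪ -p ∧
        ∀ α ∈ p, ∀ β ∈ p, α + β ∈ rootCoords → α + β ∈ p) ∧
      ∀ α ∈ p \ -p, ∀ β ∈ p \ -p, α + β ∉ rootCoords) ↔
    ∃ σ τ : Equiv.Perm (Fin 2), p.image (permCoords σ τ) = P11Coords := by
  decide +kernel

theorem isCominuscule_iff {P : Set V} (hP : P ⊆ Δroot) :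
    IsCominuscule Δroot P ↔ ∃ σ τ : Equiv.Perm (Fin 2), act σ τ P = P11 := by
  rw [Δroot_eq, Set.subset_image_iff] at hP
  obtain ⟨s, hs, rfl⟩ := hP
  lift s to Finset (ℤ × ℤ) using rootCoords.finite_toSet.subset hs
  have hs' : s ⊆ rootCoords := by exact_mod_cast hs
  rw [Δroot_eq, isCominuscule_image_iff oddCoord_injective, isCominuscule_coe_iff,
    isCominuscule_rootCoords_iff s (Finset.mem_powerset.2 hs')]
  simp only [act_oddCoord_image _ _ hs', P11_eq, oddCoord_injective.image_injective.eq_iff,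
    Finset.coe_inj]

theorem isCominuscule_P11 : IsCominuscule Δroot P11 := by
  rw [Δroot_eq, P11_eq, isCominuscule_image_iff oddCoord_injective, isCominuscule_coe_iff]
  decide +kernel

end PSL2

theorem stmt_4 (P : Set PSL2.V) (hP : P ⊆ PSL2.Δroot) :
    (IsCominuscule PSL2.Δroot P ↔
      ∃ σ τ : Equiv.Perm (Fin 2), PSL2.act σ τ P = PSL2.P11) ∧
    IsCominuscule PSL2.Δroot PSL2.P11 :=
  ⟨PSL2.isCominuscule_iff hP, PSL2.isCominuscule_P11⟩
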